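/- Let 0 ≤ γ < 1, m_0 ∈ ℕ, m_0 − 1 < α_0 ≤ m_0, α_0 > α_1 > ⋯ > α_n ≥ 0 with m_i − 1 < α_i ≤ m_i ∈ ℕ, and a_1, …, a_n ∈ ℝ. Fix k ∈ {0,…,m_0−1} and let l_k ∈ {0,…,n} satisfy m_i ≤ k for all i ∈ {l_k+1,…,n}. Define u_k(x) = x^{k−γ}/Γ(k−γ+1) + Σ_{i=l_k+1}^{n} a_i x^{k−γ+α_0−α_i} E_{(α_0−α_1,…,α_0−α_n), k+1−γ+α_0−α_i}(a_1 x^{α_0−α_1}, …, a_n x^{α_0−α_n}) for x > 0. Then I^γ u_k ∈ C^{m_0}_{−1} and (I^γ u_k)^{(l)}(0+) = 1 if l = k and (I^γ u_k)^{(l)}(0+) = 0 if l ≠ k, for every l ∈ {0,…,m_0−1}. -/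

import Mathlib

open Real MeasureTheory Filter Set Topology

/-- The Riemann–Liouville fractional integral `I^α` (with `I^0 f = f`). -/
noncomputable def RL (α : ℝ) (f : ℝ → ℝ) : ℝ → ℝ :=
  if α = 0 then f
  else fun x => (1 / Real.Gamma α) * ∫ t in (0:ℝ)..x, (x - t) ^ (α - 1) * f t

/-- The space `C_γ`: `f x = x ^ p * f₁ x` on `(0,∞)` for some `p > γ` and `f₁`
continuous on `[0,∞)`. -/
def SpaceC (γ : ℝ) (f : ℝ → ℝ) : Prop :=
  ∃ p : ℝ, γ < p ∧ ∃ f₁ : ℝ → ℝ,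
    ContinuousOn f₁ (Set.Ici 0) ∧ ∀ x > 0, f x = x ^ p * f₁ x

/-- The space `C^m_γ`: `f` is `m` times differentiable on `(0,∞)` and `f^(m) ∈ C_γ`. -/
def SpaceCm (m : ℕ) (γ : ℝ) (f : ℝ → ℝ) : Prop :=
  (∀ k < m, DifferentiableOn ℝ (iteratedDerivWithin k f (Set.Ioi 0)) (Set.Ioi 0)) ∧
  SpaceC γ (iteratedDerivWithin m f (Set.Ioi 0))

/-- The Laplace convolution `(f ⋆ g) x = ∫_0^x f (x - t) * g t dt`. -/
noncomputable def laplaceConv (f g : ℝ → ℝ) : ℝ → ℝ :=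
  fun x => ∫ t in (0:ℝ)..x, f (x - t) * g t

/-- The generalized Riemann–Liouville (Hilfer) fractional derivative of order `α`
(`n - 1 < α ≤ n`) and type `β`. -/
noncomputable def hilferD (n : ℕ) (α β : ℝ) (f : ℝ → ℝ) : ℝ → ℝ :=
  RL (β * (n - α)) (iteratedDerivWithin n (RL ((1 - β) * (n - α)) f) (Set.Ioi 0))

/-- The space `Ω^α_β` (for `n - 1 < α ≤ n`): `y ∈ C_{-1}` with
`I^{(1-β)(n-α)} y ∈ C^n_{-1}`. -/
def OmegaSpace (n : ℕ) (α β : ℝ) (y : ℝ → ℝ) : Prop :=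
  SpaceC (-1) y ∧ SpaceCm n (-1) (RL ((1 - β) * (n - α)) y)

/-- The multivariate Mittag-Leffler function
`E_{(a_1,…,a_n),b}(z_1,…,z_n)`, with the double series
`Σ_k Σ_{l_1+⋯+l_n=k}` rewritten as a sum over all multi-indices. -/
noncomputable def mittagLeffler {n : ℕ} (a : Fin n → ℝ) (b : ℝ) (z : Fin n → ℝ) : ℝ :=
  ∑' l : Fin n → ℕ,
    ((Nat.factorial (∑ j, l j) : ℝ) / ∏ j, (Nat.factorial (l j) : ℝ)) *
      (∏ j, z j ^ l j) / Real.Gamma (b + ∑ j, a j * l j)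

/-- The solution of the homogeneous-initial-condition problem:
`y_g(x) = ∫_0^x t^{α_0-1} E_{(α_0-α_1,…,α_0-α_n),α_0}(a_1 t^{α_0-α_1},…,a_n t^{α_0-α_n})
  g(x-t) dt`. -/
noncomputable def mlSol (n : ℕ) (α a : ℕ → ℝ) (g : ℝ → ℝ) : ℝ → ℝ :=
  fun x => ∫ t in (0:ℝ)..x,
    t ^ (α 0 - 1) *
      mittagLeffler (fun j : Fin n => α 0 - α (j.1 + 1)) (α 0)
        (fun j : Fin n => a (j.1 + 1) * t ^ (α 0 - α (j.1 + 1))) * g (x - t)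

/-- The building block of the solution of the inhomogeneous-initial-condition problem:
`u_k(x) = x^{k-γ}/Γ(k-γ+1) + Σ_{i=l_k+1}^{n} a_i x^{k-γ+α_0-α_i}
  E_{(α_0-α_1,…,α_0-α_n),k+1-γ+α_0-α_i}(a_1 x^{α_0-α_1},…,a_n x^{α_0-α_n})`. -/
noncomputable def uTerm (n : ℕ) (α a : ℕ → ℝ) (γ : ℝ) (lk k : ℕ) : ℝ → ℝ :=
  fun x => x ^ ((k : ℝ) - γ) / Real.Gamma ((k : ℝ) - γ + 1) +
    ∑ i ∈ Finset.Icc (lk + 1) n,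
      a i * x ^ ((k : ℝ) - γ + α 0 - α i) *
        mittagLeffler (fun j : Fin n => α 0 - α (j.1 + 1))
          ((k : ℝ) + 1 - γ + α 0 - α i)
          (fun j : Fin n => a (j.1 + 1) * x ^ (α 0 - α (j.1 + 1)))

/-- The Gamma function grows faster than any exponential. -/
lemma rpow_mul_exp_neg_le_Gamma {R s : ℝ} (hR : 1 ≤ R) (hs : 0 < s) :
    R ^ (s - 1) * exp (-R) ≤ Gamma s := by
  have of_one_le : ∀ {s : ℝ}, 1 ≤ s → R ^ (s - 1) * exp (-R) ≤ Gamma s := by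
    intro s hs
    have hR0 : 0 < R := by linarith
    have hsub : Ioi R ⊆ Ioi (0:ℝ) := Ioi_subset_Ioi hR0.le
    have hint := Real.GammaIntegral_convergent (s := s) (by linarith)
    rw [Gamma_eq_integral (by linarith), ← integral_exp_neg_Ioi, ← integral_const_mul]
    calc ∫ t in Ioi R, R ^ (s - 1) * exp (-t)
        ≤ ∫ t in Ioi R, exp (-t) * t ^ (s - 1) := by
          refine setIntegral_mono_on ((integrableOn_exp_neg_Ioi R).const_mul _)
            (hint.mono_set hsub) measurableSet_Ioi fun t ht => ?_
          rw [mul_comm]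
          have : R ^ (s - 1) ≤ t ^ (s - 1) :=
            rpow_le_rpow hR0.le (le_of_lt ht) (by linarith)
          gcongr
      _ ≤ ∫ t in Ioi 0, exp (-t) * t ^ (s - 1) := by
          refine setIntegral_mono_set hint ?_ hsub.eventuallyLE
          filter_upwards [ae_restrict_mem measurableSet_Ioi] with t ht
          have : (0:ℝ) < t := ht
          simp only [Pi.zero_apply]
          positivity
  rcases le_or_gt 1 s with h | h
  · exact of_one_le h
  · have h1 := of_one_le (s := s + 1) (by linarith)
    rw [Gamma_add_one hs.ne'] at h1
    have h2 : R ^ (s - 1) ≤ R ^ (s + 1 - 1) := rpow_le_rpow_of_exponent_le hR (by linarith)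
    have h3 := Gamma_pos_of_pos hs
    calc R ^ (s - 1) * exp (-R) ≤ R ^ (s + 1 - 1) * exp (-R) := by gcongr
      _ ≤ s * Gamma s := h1
      _ ≤ Gamma s := by nlinarith

/-- `1 / Γ(s) = s / Γ(s + 1)`, valid also at the poles thanks to `Γ(-n) = 0`. -/
lemma div_Gamma_add_one (s : ℝ) : s / Gamma (s + 1) = 1 / Gamma s := by
  rcases eq_or_ne s 0 with rfl | hs
  · simp [Gamma_zero]
  · rw [Gamma_add_one hs, div_mul_eq_div_div, div_self hs]

/-- Euler's beta integral on `[0, x]`. -/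
lemma integral_sub_rpow_mul_rpow {γ q x : ℝ} (hγ : 0 < γ) (hq : -1 < q) (hx : 0 < x) :
    ∫ t in (0:ℝ)..x, (x - t) ^ (γ - 1) * t ^ q =
      Gamma γ * (Gamma (q + 1) / Gamma (q + γ + 1) * x ^ (q + γ)) := by
  have h := Complex.betaIntegral_scaled ((q + 1 : ℝ) : ℂ) (γ : ℂ) hx
  rw [Complex.betaIntegral_eq_Gamma_mul_div _ _ (by simpa using by linarith) (by simpa using hγ),
    ← Complex.ofReal_add, Complex.Gamma_ofReal, Complex.Gamma_ofReal, Complex.Gamma_ofReal] at h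
  have hcongr : ∫ t in (0:ℝ)..x, (t : ℂ) ^ (((q + 1 : ℝ) : ℂ) - 1) * ((x : ℂ) - t) ^ ((γ : ℂ) - 1)
      = ∫ t in (0:ℝ)..x, (((x - t) ^ (γ - 1) * t ^ q : ℝ) : ℂ) := by
    refine intervalIntegral.integral_congr fun t ht => ?_
    rw [uIcc_of_le hx.le] at ht
    rw [Complex.ofReal_mul, Complex.ofReal_cpow (sub_nonneg.2 ht.2), Complex.ofReal_cpow ht.1]
    push_cast
    rw [add_sub_cancel_right, mul_comm]
  rw [hcongr, intervalIntegral.integral_ofReal] at h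
  have hpow : (x : ℂ) ^ (((q + 1 + γ : ℝ) : ℂ) - 1) = ((x ^ (q + γ) : ℝ) : ℂ) := by
    rw [Complex.ofReal_cpow hx.le]; congr 1; push_cast; ring
  rw [hpow] at h
  have h' : ∫ t in (0:ℝ)..x, (x - t) ^ (γ - 1) * t ^ q =
      x ^ (q + γ) * (Gamma (q + 1) * Gamma γ / Gamma (q + 1 + γ)) := by exact_mod_cast h
  rw [h', add_right_comm q 1 γ]
  ring

lemma intervalIntegrable_sub_rpow_mul_rpow {γ q x : ℝ} (hγ : 0 < γ) (hq : -1 < q) (hx : 0 < x) :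
    IntervalIntegrable (fun t => (x - t) ^ (γ - 1) * t ^ q) volume 0 x := by
  refine not_imp_comm.1 intervalIntegral.integral_undef ?_
  rw [integral_sub_rpow_mul_rpow hγ hq hx]
  have h1 := Gamma_pos_of_pos hγ
  have h2 := Gamma_pos_of_pos (s := q + 1) (by linarith)
  have h3 := Gamma_pos_of_pos (s := q + γ + 1) (by linarith)
  positivity

/-- A product of finitely many nonnegative summable series is summable over multi-indices. -/
lemma summable_prod_pi {ι : Type*} [Fintype ι] {f : ι → ℕ → ℝ} (hf0 : ∀ j m, 0 ≤ f j m)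
    (hf : ∀ j, Summable (f j)) : Summable fun l : ι → ℕ => ∏ j, f j (l j) := by
  classical
  refine summable_of_sum_le (c := ∏ j, ∑' m, f j m)
    (fun l => Finset.prod_nonneg fun j _ => hf0 j _) fun s => ?_
  have hsub : s ⊆ Fintype.piFinset fun j => s.image fun l => l j := fun l hl =>
    Fintype.mem_piFinset.2 fun j => Finset.mem_image_of_mem (fun l : ι → ℕ => l j) hl
  calc ∑ l ∈ s, ∏ j, f j (l j)
      ≤ ∑ l ∈ Fintype.piFinset fun j => s.image fun l => l j, ∏ j, f j (l j) :=
        Finset.sum_le_sum_of_subset_of_nonneg hsub fun l _ _ =>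
          Finset.prod_nonneg fun j _ => hf0 j _
    _ = ∏ j, ∑ m ∈ s.image fun l => l j, f j m := (Finset.prod_univ_sum _ _).symm
    _ ≤ ∏ j, ∑' m, f j m :=
        Finset.prod_le_prod (fun j _ => Finset.sum_nonneg fun m _ => hf0 j m)
          fun j _ => (hf j).sum_le_tsum _ fun m _ => hf0 j m

/-- A multinomial coefficient is at most the number of words it helps to count. -/
lemma factorial_sum_div_prod_le {ι : Type*} [Fintype ι] (l : ι → ℕ) :
    ((∑ j, l j).factorial : ℝ) / ∏ j, ((l j).factorial : ℝ) ≤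
      (Fintype.card ι : ℝ) ^ ∑ j, l j := by
  classical
  have h := Finset.sum_pow_eq_sum_piAntidiag (Finset.univ : Finset ι) (fun _ => (1:ℕ)) (∑ j, l j)
  simp only [Finset.sum_const, smul_eq_mul, mul_one, one_pow, Finset.prod_const_one,
    Finset.card_univ] at h
  have hle : Nat.multinomial Finset.univ l ≤ Fintype.card ι ^ ∑ j, l j := by
    rw [h]
    exact_mod_cast Finset.single_le_sum (f := fun k => Nat.multinomial Finset.univ k)
      (fun _ _ => Nat.zero_le _) (Finset.mem_piAntidiag.2 ⟨rfl, by simp⟩)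
  have hspec := Nat.multinomial_spec Finset.univ l
  rw [div_le_iff₀ (by positivity)]
  calc ((∑ j, l j).factorial : ℝ)
      = (∏ j, ((l j).factorial : ℝ)) * Nat.multinomial Finset.univ l := by
        exact_mod_cast hspec.symm
    _ ≤ (∏ j, ((l j).factorial : ℝ)) * (Fintype.card ι : ℝ) ^ ∑ j, l j := by
        gcongr; exact_mod_cast hle
    _ = _ := mul_comm _ _

/-- The coefficients of the multivariate Mittag-Leffler series in the variables
`a_j x ^ d_j`. -/
noncomputable def mlCoeff {n : ℕ} (a : Fin n → ℝ) (l : Fin n → ℕ) : ℝ :=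
  ((Nat.factorial (∑ j, l j) : ℝ) / ∏ j, (Nat.factorial (l j) : ℝ)) * ∏ j, a j ^ l j

/-- The exponents of the multivariate Mittag-Leffler series in the variables
`a_j x ^ d_j`. -/
noncomputable def mlExponent {n : ℕ} (d : Fin n → ℝ) (l : Fin n → ℕ) : ℝ := ∑ j, d j * l j

lemma mlExponent_nonneg {n : ℕ} {d : Fin n → ℝ} (hd : ∀ j, 0 < d j) (l : Fin n → ℕ) :
    0 ≤ mlExponent d l :=
  Finset.sum_nonneg fun j _ => mul_nonneg (hd j).le (Nat.cast_nonneg _)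

lemma rpow_mlExponent {n : ℕ} (d : Fin n → ℝ) (l : Fin n → ℕ) {x : ℝ} (hx : 0 < x) :
    x ^ mlExponent d l = ∏ j, (x ^ d j) ^ l j := by
  rw [mlExponent, rpow_sum_of_pos hx]
  exact Finset.prod_congr rfl fun j _ => by rw [rpow_mul hx.le, rpow_natCast]

lemma abs_mlCoeff_le {n : ℕ} (a : Fin n → ℝ) (l : Fin n → ℕ) :
    |mlCoeff a l| ≤ ∏ j, (n * |a j|) ^ l j := by
  have h := factorial_sum_div_prod_le l
  rw [Fintype.card_fin] at h
  rw [mlCoeff, abs_mul, Finset.abs_prod, abs_of_nonneg (by positivity)]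
  simp_rw [abs_pow, mul_pow]
  rw [Finset.prod_mul_distrib, Finset.prod_pow_eq_pow_sum]
  gcongr

/-- Absolute convergence of the multivariate Mittag-Leffler series. -/
lemma summable_mlCoeff {n : ℕ} (a : Fin n → ℝ) {d : Fin n → ℝ} (hd : ∀ j, 0 < d j)
    {b x : ℝ} (hb : 0 < b) (hx : 0 < x) :
    Summable fun l : Fin n → ℕ =>
      |mlCoeff a l| * x ^ mlExponent d l / Gamma (b + mlExponent d l) := by
  obtain ⟨R, hR1, hR⟩ : ∃ R : ℝ, 1 ≤ R ∧ ∀ j, n * |a j| * (x / R) ^ d j < 1 := by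
    have h : ∀ᶠ R : ℝ in atTop, ∀ j, n * |a j| * (x / R) ^ d j < 1 := by
      refine eventually_all.2 fun j => ?_
      have h0 : Tendsto (fun R : ℝ => n * |a j| * (x / R) ^ d j) atTop (𝓝 0) := by
        have := ((tendsto_const_nhds (x := x)).div_atTop tendsto_id).rpow_const
          (p := d j) (Or.inr (hd j).le)
        rw [zero_rpow (hd j).ne'] at this
        simpa using this.const_mul (n * |a j|)
      exact h0.eventually_lt_const one_pos
    obtain ⟨R, h1, h2⟩ := ((eventually_ge_atTop 1).and h).exists
    exact ⟨R, h1, h2⟩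
  have hR0 : 0 < R := by linarith
  have hgeom : Summable fun l : Fin n → ℕ =>
      ∏ j, (n * |a j| * (x / R) ^ d j) ^ l j :=
    summable_prod_pi (f := fun j m => (n * |a j| * (x / R) ^ d j) ^ m)
      (fun j m => by positivity)
      fun j => summable_geometric_of_lt_one (by positivity) (hR j)
  refine Summable.of_nonneg_of_le (fun l => ?_) (fun l => ?_)
    (hgeom.mul_left (R ^ (1 - b) * exp R))
  · have := Gamma_pos_of_pos (s := b + mlExponent d l)
      (by linarith [mlExponent_nonneg hd l])
    positivity
  · have he := mlExponent_nonneg hd l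
    have hΓ := rpow_mul_exp_neg_le_Gamma hR1 (s := b + mlExponent d l) (by linarith)
    have hinv : (R ^ (b + mlExponent d l - 1) * exp (-R))⁻¹ =
        R ^ (1 - b) * exp R * (R ^ mlExponent d l)⁻¹ := by
      rw [mul_inv, exp_neg, inv_inv, ← rpow_neg hR0.le, ← rpow_neg hR0.le,
        mul_right_comm, ← rpow_add hR0]
      congr 2
      ring
    calc |mlCoeff a l| * x ^ mlExponent d l / Gamma (b + mlExponent d l)
        ≤ (∏ j, (n * |a j|) ^ l j) * x ^ mlExponent d l /
            (R ^ (b + mlExponent d l - 1) * exp (-R)) := by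
          gcongr
          exact abs_mlCoeff_le a l
      _ = R ^ (1 - b) * exp R * ((∏ j, (n * |a j|) ^ l j) *
            (x ^ mlExponent d l / R ^ mlExponent d l)) := by
          rw [div_eq_mul_inv _ (_ * _), hinv]; ring
      _ = R ^ (1 - b) * exp R * ∏ j, (n * |a j| * (x / R) ^ d j) ^ l j := by
          rw [← div_rpow hx.le hR0.le, rpow_mlExponent d l (div_pos hx hR0),
            ← Finset.prod_mul_distrib]
          simp_rw [mul_pow]

/-- The generalized power series `∑ c_i x ^ (p + e_i) / Γ(p + 1 + e_i)`. -/
noncomputable def gammaSeries {ι : Type*} (c e : ι → ℝ) (p x : ℝ) : ℝ :=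
  ∑' i, c i * (x ^ (p + e i) / Gamma (p + 1 + e i))

section gammaSeries

variable {ι : Type*} {c e : ι → ℝ}

/-- Factoring out the leading power, a generalized power series becomes a function that is
continuous up to the origin. -/
lemma exists_continuousOn_gammaSeries (he : ∀ i, 0 ≤ e i)
    (hS : ∀ b > 0, ∀ x > 0, Summable fun i => |c i| * x ^ e i / Gamma (b + e i))
    {p : ℝ} (hp : -1 < p) :
    ∃ H : ℝ → ℝ, ContinuousOn H (Ici 0) ∧ ∀ x > 0, gammaSeries c e p x = x ^ p * H x := by
  refine ⟨fun x => ∑' i, c i * (x ^ e i / Gamma (p + 1 + e i)), ?_, fun x hx => ?_⟩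
  · intro x hx
    have hx0 : 0 ≤ x := hx
    have hcont : ContinuousOn (fun x : ℝ => ∑' i, c i * (x ^ e i / Gamma (p + 1 + e i)))
        (Icc 0 (x + 1)) := by
      refine continuousOn_tsum (fun i => ?_) (hS (p + 1) (by linarith) (x + 1) (by linarith))
        fun i y hy => ?_
      · exact ((continuous_rpow_const (he i)).div_const _).const_mul _ |>.continuousOn
      · have hΓ := Gamma_pos_of_pos (s := p + 1 + e i) (by linarith [he i])
        rw [norm_mul, norm_div, norm_eq_abs, norm_of_nonneg (rpow_nonneg hy.1 _),
          norm_of_nonneg hΓ.le, ← mul_div_assoc]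
        have := rpow_le_rpow hy.1 hy.2 (he i)
        gcongr
    refine (hcont x ⟨hx0, by linarith⟩).mono_of_mem_nhdsWithin ?_
    rw [← Ici_inter_Iic]
    exact inter_mem self_mem_nhdsWithin (mem_nhdsWithin_of_mem_nhds (Iic_mem_nhds (by linarith)))
  · rw [gammaSeries, ← tsum_mul_left]
    refine tsum_congr fun i => ?_
    rw [rpow_add hx]
    ring

lemma summable_gammaSeries
    (hS : ∀ b > 0, ∀ x > 0, Summable fun i => |c i| * x ^ e i / Gamma (b + e i))
    {p : ℝ} (hp : -1 < p) {x : ℝ} (hx : 0 < x) :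
    Summable fun i => |c i| * (x ^ (p + e i) / Gamma (p + 1 + e i)) := by
  refine ((hS (p + 1) (by linarith) x hx).mul_left (x ^ p)).congr fun i => ?_
  rw [rpow_add hx]
  ring

lemma hasDerivAt_rpow_div_Gamma (s : ℝ) {x : ℝ} (hx : 0 < x) :
    HasDerivAt (fun x : ℝ => x ^ s / Gamma (s + 1)) (x ^ (s - 1) / Gamma s) x := by
  convert! (Real.hasDerivAt_rpow_const (p := s) (Or.inl hx.ne')).div_const (Gamma (s + 1)) using 1
  rw [mul_div_right_comm, div_Gamma_add_one]
  ring

/-- Termwise differentiation of a generalized power series. -/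
lemma hasDerivAt_gammaSeries (he : ∀ i, 0 ≤ e i)
    (hS : ∀ b > 0, ∀ x > 0, Summable fun i => |c i| * x ^ e i / Gamma (b + e i))
    {p : ℝ} (hp : 0 < p) {x : ℝ} (hx : 0 < x) :
    HasDerivAt (gammaSeries c e p) (gammaSeries c e (p - 1) x) x := by
  have hmem : x ∈ Ioo (x / 2) (x + 1) := ⟨by linarith, by linarith⟩
  refine hasDerivAt_tsum_of_isPreconnected
    (u := fun i => ((x / 2) ^ (p - 1) + (x + 1) ^ (p - 1)) *
      (|c i| * (x + 1) ^ e i / Gamma (p + e i)))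
    ((hS p hp (x + 1) (by linarith)).mul_left _) isOpen_Ioo isPreconnected_Ioo
    (g' := fun i y => c i * (y ^ (p - 1 + e i) / Gamma (p - 1 + 1 + e i)))
    (fun i y hy => ?_) (fun i y hy => ?_) hmem ?_ hmem
  · have hy0 : 0 < y := by linarith [hy.1]
    have h := (hasDerivAt_rpow_div_Gamma (p + e i) hy0).const_mul (c i)
    rw [add_right_comm p _ 1, add_sub_right_comm] at h
    rwa [sub_add_cancel]
  · have hy0 : 0 < y := by linarith [hy.1]
    have hΓ := Gamma_pos_of_pos (s := p + e i) (by linarith [he i])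
    have h1 : y ^ e i ≤ (x + 1) ^ e i := rpow_le_rpow hy0.le hy.2.le (he i)
    have h2 : y ^ (p - 1) ≤ (x / 2) ^ (p - 1) + (x + 1) ^ (p - 1) := by
      rcases le_total 0 (p - 1) with h | h
      · have := rpow_le_rpow hy0.le hy.2.le h
        have : 0 < (x / 2) ^ (p - 1) := rpow_pos_of_pos (by linarith) _
        linarith
      · have := rpow_le_rpow_of_nonpos (by linarith) hy.1.le h
        have : 0 < (x + 1) ^ (p - 1) := rpow_pos_of_pos (by linarith) _
        linarith
    rw [sub_add_cancel, norm_mul, norm_div, norm_eq_abs, norm_of_nonneg (by positivity),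
      norm_of_nonneg hΓ.le, rpow_add hy0]
    calc |c i| * (y ^ (p - 1) * y ^ e i / Gamma (p + e i))
        ≤ |c i| * (((x / 2) ^ (p - 1) + (x + 1) ^ (p - 1)) * (x + 1) ^ e i / Gamma (p + e i)) := by
          gcongr
      _ = _ := by ring
  · refine Summable.of_norm ((summable_gammaSeries hS (p := p) (by linarith) hx).congr
      fun i => ?_)
    have hΓ := Gamma_pos_of_pos (s := p + 1 + e i) (by linarith [he i])
    rw [norm_mul, norm_eq_abs, norm_of_nonneg (by positivity)]

lemma intervalIntegrable_sub_rpow_mul_gammaSeries (he : ∀ i, 0 ≤ e i)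
    (hS : ∀ b > 0, ∀ x > 0, Summable fun i => |c i| * x ^ e i / Gamma (b + e i))
    {γ p : ℝ} (hγ : 0 < γ) (hp : -1 < p) {x : ℝ} (hx : 0 < x) :
    IntervalIntegrable (fun t => (x - t) ^ (γ - 1) * gammaSeries c e p t) volume 0 x := by
  obtain ⟨H, hH, hHeq⟩ := exists_continuousOn_gammaSeries he hS hp
  refine ((intervalIntegrable_sub_rpow_mul_rpow hγ hp hx).mul_continuousOn
    (hH.mono ?_)).congr fun t ht => ?_
  · rw [uIcc_of_le hx.le]
    exact Icc_subset_Ici_self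
  · rw [uIoc_of_le hx.le] at ht
    rw [hHeq t ht.1, mul_assoc]

/-- Termwise fractional integration of a generalized power series. -/
lemma integral_sub_rpow_mul_gammaSeries [Countable ι] (he : ∀ i, 0 ≤ e i)
    (hS : ∀ b > 0, ∀ x > 0, Summable fun i => |c i| * x ^ e i / Gamma (b + e i))
    {γ p : ℝ} (hγ : 0 < γ) (hp : -1 < p) {x : ℝ} (hx : 0 < x) :
    ∫ t in (0:ℝ)..x, (x - t) ^ (γ - 1) * gammaSeries c e p t =
      Gamma γ * gammaSeries c e (p + γ) x := by
  set F : ι → ℝ → ℝ := fun i t =>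
    c i / Gamma (p + 1 + e i) * ((x - t) ^ (γ - 1) * t ^ (p + e i)) with hF
  have hΓ : ∀ i, 0 < Gamma (p + 1 + e i) := fun i => Gamma_pos_of_pos (by linarith [he i])
  have hint : ∀ i, Integrable (F i) (volume.restrict (Ioc 0 x)) := fun i =>
    ((intervalIntegrable_iff_integrableOn_Ioc_of_le hx.le).1
      (intervalIntegrable_sub_rpow_mul_rpow hγ (by linarith [he i]) hx)).const_mul _
  have hval : ∀ i, ∫ t in Ioc 0 x, (x - t) ^ (γ - 1) * t ^ (p + e i) =
      Gamma γ * (Gamma (p + 1 + e i) * (x ^ (p + γ + e i) / Gamma (p + γ + 1 + e i))) := by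
    intro i
    rw [← intervalIntegral.integral_of_le hx.le,
      integral_sub_rpow_mul_rpow hγ (by linarith [he i]) hx, add_right_comm p (e i) 1,
      add_right_comm p (e i) γ, add_right_comm (p + γ) (e i) 1]
    ring
  have hnorm : ∀ i, ∫ t in Ioc 0 x, ‖F i t‖ =
      Gamma γ * (|c i| * (x ^ (p + γ + e i) / Gamma (p + γ + 1 + e i))) := by
    intro i
    have : ∫ t in Ioc 0 x, ‖F i t‖ =
        ∫ t in Ioc 0 x, |c i| / Gamma (p + 1 + e i) * ((x - t) ^ (γ - 1) * t ^ (p + e i)) := by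
      refine setIntegral_congr_fun measurableSet_Ioc fun t ht => ?_
      have h1 : 0 ≤ (x - t) ^ (γ - 1) := rpow_nonneg (sub_nonneg.2 ht.2) _
      have h2 : 0 ≤ t ^ (p + e i) := rpow_nonneg ht.1.le _
      simp only [hF]
      rw [norm_mul, norm_div, norm_eq_abs, norm_of_nonneg (hΓ i).le,
        norm_of_nonneg (mul_nonneg h1 h2)]
    rw [this, integral_const_mul, hval]
    field_simp [(hΓ i).ne']
  have hsum : Summable fun i => ∫ t in Ioc 0 x, ‖F i t‖ := by
    simp_rw [hnorm]
    exact (summable_gammaSeries hS (by linarith) hx).mul_left _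
  have htsum : ∀ t, (x - t) ^ (γ - 1) * gammaSeries c e p t = ∑' i, F i t := by
    intro t
    rw [gammaSeries, ← tsum_mul_left]
    exact tsum_congr fun i => by simp only [hF]; ring
  have hFint : ∀ i, ∫ t in Ioc 0 x, F i t =
      Gamma γ * (c i * (x ^ (p + γ + e i) / Gamma (p + γ + 1 + e i))) := by
    intro i
    simp only [hF]
    rw [integral_const_mul, hval]
    field_simp [(hΓ i).ne']
  simp_rw [htsum]
  rw [intervalIntegral.integral_of_le hx.le, ← integral_tsum_of_summable_integral_norm hint hsum,
    gammaSeries, ← tsum_mul_left]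
  exact tsum_congr hFint

end gammaSeries

lemma rpow_mul_mittagLeffler {n : ℕ} (a d : Fin n → ℝ) (p : ℝ) {x : ℝ} (hx : 0 < x) :
    x ^ p * mittagLeffler d (p + 1) (fun j => a j * x ^ d j) =
      gammaSeries (mlCoeff a) (mlExponent d) p x := by
  rw [mittagLeffler, gammaSeries, ← tsum_mul_left]
  refine tsum_congr fun l => ?_
  rw [rpow_add hx, rpow_mlExponent d l hx, mlCoeff, mlExponent]
  simp_rw [mul_pow]
  rw [Finset.prod_mul_distrib]
  ring

/-- Fractional integration of a finite combination of generalized power series. -/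
lemma RL_rpow_add_sum_gammaSeries {ι κ : Type*} [Countable ι] {c e : ι → ℝ} (he : ∀ i, 0 ≤ e i)
    (hS : ∀ b > 0, ∀ x > 0, Summable fun i => |c i| * x ^ e i / Gamma (b + e i))
    {γ q : ℝ} (hγ : 0 ≤ γ) (hq : -1 < q - γ) (s : Finset κ) (A p : κ → ℝ)
    (hp : ∀ i ∈ s, -1 < p i - γ) {f : ℝ → ℝ}
    (hf : ∀ x > 0, f x = x ^ (q - γ) / Gamma (q - γ + 1) +
      ∑ i ∈ s, A i * gammaSeries c e (p i - γ) x) {x : ℝ} (hx : 0 < x) :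
    RL γ f x = x ^ q / Gamma (q + 1) + ∑ i ∈ s, A i * gammaSeries c e (p i) x := by
  rcases hγ.eq_or_lt with rfl | hγ
  · simpa [RL] using hf x hx
  have hΓ := Gamma_pos_of_pos hγ
  have hΓq := Gamma_pos_of_pos (s := q - γ + 1) (by linarith)
  have hcongr : ∫ t in (0:ℝ)..x, (x - t) ^ (γ - 1) * f t =
      ∫ t in (0:ℝ)..x, ((Gamma (q - γ + 1))⁻¹ * ((x - t) ^ (γ - 1) * t ^ (q - γ)) +
        ∑ i ∈ s, A i * ((x - t) ^ (γ - 1) * gammaSeries c e (p i - γ) t)) := by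
    refine intervalIntegral.integral_congr_ae (Eventually.of_forall fun t ht => ?_)
    rw [uIoc_of_le hx.le] at ht
    rw [hf t ht.1, mul_add, Finset.mul_sum]
    congr 1
    · ring
    · exact Finset.sum_congr rfl fun i _ => by ring
  have hint := fun i (hi : i ∈ s) =>
    (intervalIntegrable_sub_rpow_mul_gammaSeries he hS hγ (hp i hi) hx).const_mul (A i)
  rw [RL, if_neg hγ.ne', hcongr, intervalIntegral.integral_add
    ((intervalIntegrable_sub_rpow_mul_rpow hγ hq hx).const_mul _)
    (by simpa only [Finset.sum_fn] using IntervalIntegrable.sum s hint),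
    intervalIntegral.integral_finsetSum hint, intervalIntegral.integral_const_mul,
    integral_sub_rpow_mul_rpow hγ hq hx, sub_add_cancel, mul_add, Finset.mul_sum]
  congr 1
  · field_simp
  · refine Finset.sum_congr rfl fun i hi => ?_
    rw [intervalIntegral.integral_const_mul,
      integral_sub_rpow_mul_gammaSeries he hS hγ (hp i hi) hx, sub_add_cancel]
    field_simp

lemma SpaceC.add {γ : ℝ} {f g : ℝ → ℝ} (hf : SpaceC γ f) (hg : SpaceC γ g) :
    SpaceC γ fun x => f x + g x := by
  obtain ⟨p, hp, f₁, hf₁, hf⟩ := hf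
  obtain ⟨q, hq, g₁, hg₁, hg⟩ := hg
  refine ⟨min p q, lt_min hp hq, fun x => x ^ (p - min p q) * f₁ x + x ^ (q - min p q) * g₁ x,
    ?_, fun x hx => ?_⟩
  · exact ((continuous_rpow_const (sub_nonneg.2 (min_le_left p q))).continuousOn.mul hf₁).add
      ((continuous_rpow_const (sub_nonneg.2 (min_le_right p q))).continuousOn.mul hg₁)
  · simp only [hf x hx, hg x hx]
    rw [mul_add, ← mul_assoc, ← mul_assoc, ← rpow_add hx, ← rpow_add hx,
      add_sub_cancel, add_sub_cancel]

lemma SpaceC.zero {γ : ℝ} : SpaceC γ fun _ => 0 :=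
  ⟨γ + 1, by linarith, fun _ => 0, continuousOn_const, by simp⟩

lemma SpaceC.const_mul {γ : ℝ} {f : ℝ → ℝ} (hf : SpaceC γ f) (A : ℝ) :
    SpaceC γ fun x => A * f x := by
  obtain ⟨p, hp, f₁, hf₁, hf⟩ := hf
  exact ⟨p, hp, fun x => A * f₁ x, hf₁.const_mul A, fun x hx => by simp only [hf x hx]; ring⟩

lemma SpaceC.sum {κ : Type*} {γ : ℝ} {s : Finset κ} {f : κ → ℝ → ℝ}
    (hf : ∀ i ∈ s, SpaceC γ (f i)) : SpaceC γ fun x => ∑ i ∈ s, f i x := by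
  classical
  induction s using Finset.induction_on with
  | empty => simpa using SpaceC.zero
  | insert i s hi ih =>
    simp_rw [Finset.sum_insert hi]
    exact (hf i (Finset.mem_insert_self i s)).add
      (ih fun j hj => hf j (Finset.mem_insert_of_mem hj))

lemma SpaceC.congr {γ : ℝ} {f g : ℝ → ℝ} (hf : SpaceC γ f) (h : EqOn g f (Ioi 0)) :
    SpaceC γ g := by
  obtain ⟨p, hp, f₁, hf₁, hf⟩ := hf
  exact ⟨p, hp, f₁, hf₁, fun x hx => (h hx).trans (hf x hx)⟩

lemma tendsto_gammaSeries {ι : Type*} {c e : ι → ℝ} (he : ∀ i, 0 ≤ e i)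
    (hS : ∀ b > 0, ∀ x > 0, Summable fun i => |c i| * x ^ e i / Gamma (b + e i))
    {p : ℝ} (hp : 0 < p) : Tendsto (gammaSeries c e p) (𝓝[>] 0) (𝓝 0) := by
  obtain ⟨H, hH, hHeq⟩ := exists_continuousOn_gammaSeries he hS (p := p) (by linarith)
  have h1 : Tendsto H (𝓝[>] 0) (𝓝 (H 0)) :=
    (hH 0 self_mem_Ici).mono_left (nhdsWithin_mono _ Ioi_subset_Ici_self)
  have h2 : Tendsto (fun x : ℝ => x ^ p) (𝓝[>] 0) (𝓝 0) := by
    have := (continuous_rpow_const hp.le).tendsto (0:ℝ)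
    rw [zero_rpow hp.ne'] at this
    exact this.mono_left nhdsWithin_le_nhds
  have h3 := h2.mul h1
  rw [zero_mul] at h3
  refine h3.congr' ?_
  filter_upwards [self_mem_nhdsWithin] with x hx using (hHeq x hx).symm

/-- The reciprocal Gamma function vanishes at the nonpositive integers. -/
lemma Gamma_natCast_sub_add_one {k l : ℕ} (h : k < l) : Gamma ((k : ℝ) - l + 1) = 0 := by
  obtain ⟨r, rfl⟩ := Nat.exists_eq_add_of_lt h
  rw [← Gamma_neg_nat_eq_zero r]
  congr 1
  push_cast
  ring

lemma tendsto_rpow_sub_div_Gamma (k l : ℕ) :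
    Tendsto (fun x : ℝ => x ^ ((k : ℝ) - l) / Gamma ((k : ℝ) - l + 1)) (𝓝[>] 0)
      (𝓝 (if l = k then 1 else 0)) := by
  rcases lt_trichotomy l k with h | rfl | h
  · have hpos : (0:ℝ) < (k : ℝ) - l := sub_pos.2 (by exact_mod_cast h)
    have := ((continuous_rpow_const hpos.le).div_const (Gamma ((k : ℝ) - l + 1))).tendsto (0:ℝ)
    rw [zero_rpow hpos.ne', zero_div] at this
    rw [if_neg h.ne]
    exact this.mono_left nhdsWithin_le_nhds
  · simp
  · simp [Gamma_natCast_sub_add_one h, h.ne']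

/-- A finite combination of generalized power series with leading exponents `p i > N - 1`, plus
`x ^ k / k!` with `k < N`, lies in `C^N_{-1}` and has initial values `δ_{lk}`. -/
lemma spaceCm_and_tendsto_of_eq_gammaSeries {ι κ : Type*} {c e : ι → ℝ} (he : ∀ i, 0 ≤ e i)
    (hS : ∀ b > 0, ∀ x > 0, Summable fun i => |c i| * x ^ e i / Gamma (b + e i))
    {k N : ℕ} (hk : k < N) (s : Finset κ) (A p : κ → ℝ) (hp : ∀ i ∈ s, (N : ℝ) - 1 < p i)
    {f : ℝ → ℝ} (hf : ∀ x > 0, f x = x ^ (k : ℝ) / Gamma ((k : ℝ) + 1) +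
      ∑ i ∈ s, A i * gammaSeries c e (p i) x) :
    SpaceCm N (-1) f ∧ ∀ l < N,
      Tendsto (iteratedDerivWithin l f (Ioi 0)) (𝓝[>] 0) (𝓝 (if l = k then 1 else 0)) := by
  set D : ℕ → ℝ → ℝ := fun l x => x ^ ((k : ℝ) - l) / Gamma ((k : ℝ) - l + 1) +
    ∑ i ∈ s, A i * gammaSeries c e (p i - l) x with hD
  have hpos : ∀ l < N, ∀ i ∈ s, 0 < p i - l := fun l hl i hi => by
    have : (l : ℝ) + 1 ≤ N := by exact_mod_cast hl
    linarith [hp i hi]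
  have hderiv : ∀ l < N, ∀ x > 0, HasDerivAt (D l) (D (l + 1) x) x := by
    intro l hl x hx
    have h1 := hasDerivAt_rpow_div_Gamma ((k : ℝ) - l) hx
    have h2 := HasDerivAt.fun_sum (u := s) fun i hi =>
      (hasDerivAt_gammaSeries he hS (hpos l hl i hi) hx).const_mul (A i)
    have h := h1.add h2
    simp only [hD]
    push_cast
    simp_rw [← sub_sub]
    rw [sub_add_cancel]
    exact h
  have hiter : ∀ l ≤ N, EqOn (iteratedDerivWithin l f (Ioi 0)) (D l) (Ioi 0) := by
    intro l
    induction l with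
    | zero =>
      intro _ x hx
      simpa [hD] using hf x hx
    | succ l ih =>
      intro hl x hx
      rw [iteratedDerivWithin_succ, derivWithin_congr (ih (by omega)) (ih (by omega) hx)]
      exact (hderiv l hl x hx).hasDerivWithinAt.derivWithin (isOpen_Ioi.uniqueDiffWithinAt hx)
  refine ⟨⟨fun l hl => ?_, ?_⟩, fun l hl => ?_⟩
  · exact DifferentiableOn.congr
      (fun x hx => (hderiv l hl x hx).differentiableAt.differentiableWithinAt) (hiter l hl.le)
  · refine SpaceC.congr ?_ (hiter N le_rfl)
    simp only [hD, Gamma_natCast_sub_add_one hk, div_zero, zero_add]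
    refine SpaceC.sum fun i hi => SpaceC.const_mul ?_ _
    have hpN : -1 < p i - N := by linarith [hp i hi]
    exact ⟨p i - N, hpN, exists_continuousOn_gammaSeries he hS hpN⟩
  · have hlim : Tendsto (D l) (𝓝[>] 0) (𝓝 ((if l = k then 1 else 0) + ∑ i ∈ s, A i * 0)) :=
      (tendsto_rpow_sub_div_Gamma k l).add (tendsto_finsetSum _ fun i hi =>
        (tendsto_gammaSeries he hS (hpos l hl i hi)).const_mul (A i))
    simp only [mul_zero, Finset.sum_const_zero, add_zero] at hlim
    refine hlim.congr' ?_
    filter_upwards [self_mem_nhdsWithin] with x hx using (hiter l hl.le hx).symm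

/-- for `0 ≤ γ < 1`, `k < m_0` and `l_k` such that `m_i ≤ k` for
`l_k < i ≤ n`, the function
`u_k(x) = x^{k-γ}/Γ(k-γ+1) + Σ_{i=l_k+1}^n a_i x^{k-γ+α_0-α_i} E_{⋯,k+1-γ+α_0-α_i}(⋯)`
satisfies `I^γ u_k ∈ C^{m_0}_{-1}` and `(I^γ u_k)^{(l)}(0+) = δ_{lk}` for `l < m_0`. -/
theorem uTerm_initial_values (n : ℕ) (γ : ℝ) (hγ0 : 0 ≤ γ) (hγ1 : γ < 1)
    (m : ℕ → ℕ) (α : ℕ → ℝ) (a : ℕ → ℝ)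
    (hm0 : 1 ≤ m 0)
    (hm : ∀ i ≤ n, (m i : ℝ) - 1 < α i ∧ α i ≤ m i)
    (hdec : ∀ i < n, α (i + 1) < α i)
    (hαn : 0 ≤ α n)
    (k : ℕ) (hk : k < m 0)
    (lk : ℕ) (hlkn : lk ≤ n)
    (hlk : ∀ i, lk + 1 ≤ i → i ≤ n → m i ≤ k) :
    SpaceCm (m 0) (-1) (RL γ (uTerm n α a γ lk k)) ∧
    ∀ l < m 0,
      Tendsto (iteratedDerivWithin l (RL γ (uTerm n α a γ lk k)) (Set.Ioi 0))
        (𝓝[>] (0:ℝ)) (𝓝 (if l = k then 1 else 0)) := by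
  have hanti : ∀ i, 1 ≤ i → i ≤ n → α i < α 0 := by
    intro i hi
    induction i, hi using Nat.le_induction with
    | base => exact fun h => hdec 0 (by omega)
    | succ i _ ih => exact fun h => (hdec i (by omega)).trans (ih (by omega))
  have hd : ∀ j : Fin n, 0 < α 0 - α (j.1 + 1) := fun j =>
    sub_pos.2 (hanti _ (by omega) (by omega))
  have he := mlExponent_nonneg hd
  have hS := fun b (hb : b > 0) x (hx : x > 0) =>
    summable_mlCoeff (fun j : Fin n => a (j.1 + 1)) hd (b := b) (x := x) hb hx
  have hp : ∀ i ∈ Finset.Icc (lk + 1) n, (m 0 : ℝ) - 1 < (k : ℝ) + α 0 - α i := by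
    intro i hi
    rw [Finset.mem_Icc] at hi
    have h1 : (m i : ℝ) ≤ k := by exact_mod_cast hlk i hi.1 hi.2
    linarith [(hm i hi.2).2, (hm 0 n.zero_le).1]
  have hk0 : (0:ℝ) ≤ k := k.cast_nonneg
  have hm0' : (1:ℝ) ≤ m 0 := by exact_mod_cast hm0
  refine spaceCm_and_tendsto_of_eq_gammaSeries he hS hk (Finset.Icc (lk + 1) n) a _ hp
    fun x hx => RL_rpow_add_sum_gammaSeries he hS hγ0 (by linarith) _ a _
      (fun i hi => by linarith [hp i hi]) (fun x hx => ?_) hx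
  rw [uTerm]
  congr 1
  refine Finset.sum_congr rfl fun i _ => ?_
  rw [← rpow_mul_mittagLeffler _ _ _ hx, mul_assoc]
  congr 3 <;> ring
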